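/- Let M be a bounded open subset of ℝ² with finite Lebesgue measure λ. Let N ≥ 1, let a₁ ≤ a₂ ≤ … ≤ a_N be real numbers, let A₁, …, A_N be pairwise disjoint measurable subsets of M with ⋃ᵢ Aᵢ = M, and let ω₀ = Σ_{i=1}^N aᵢ 𝟙_{Aᵢ}. Then for ω ∈ L^∞(M) the following are equivalent: (a) there exists a bistochastic kernel K on M with ω = Kω₀ almost everywhere; (b) ∫_M ω dλ = ∫_M ω₀ dλ and for every i = 1, …, N one has ∫_M (ω − aᵢ)₊ dλ ≤ ∫_M (ω₀ − aᵢ)₊ dλ, where (t)₊ := max(t,0). Moreover, these conditions imply a₁ ≤ ω ≤ a_N almost everywhere and ∫_M (ω − c)₊ dλ ≤ ∫_M (ω₀ − c)₊ dλ for every c ∈ ℝ. -/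

import Mathlib

open MeasureTheory ProbabilityTheory

/-- A bistochastic kernel on a measure space `(X, μ)`. -/
def IsBistochastic {X : Type*} [MeasurableSpace X] (μ : Measure X)
    (κ : Kernel X X) : Prop :=
  IsMarkovKernel κ ∧ ∀ A : Set X, MeasurableSet A → ∫⁻ x, κ x A ∂μ = μ A

/-- `(Kω)(x) := ∫ ω(y) dκ_x(y)`. -/
noncomputable def kernApply {X : Type*} [MeasurableSpace X]
    (κ : Kernel X X) (ω : X → ℝ) (x : X) : ℝ :=
  ∫ y, ω y ∂(κ x)

/-- Up to an affine part, a function on the points `b 0 < … < b n` is the superposition of the ramps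
`t ↦ (t - b (k + 1))₊` weighted by the jumps of its slope. -/
lemma eq_affine_add_sum_ramps {b : ℕ → ℝ} (hb : StrictMono b) (g s : ℕ → ℝ)
    (hs : ∀ k, s k * (b (k + 1) - b k) = g (k + 1) - g k) {n i : ℕ} (hi : i ≤ n) :
    g i = g 0 + s 0 * (b i - b 0) +
      ∑ k ∈ Finset.range n, (s (k + 1) - s k) * max (b i - b (k + 1)) 0 := by
  have truncated : ∀ i, g i = g 0 + s 0 * (b i - b 0) +
      ∑ k ∈ Finset.range i, (s (k + 1) - s k) * (b i - b (k + 1)) := by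
    intro i
    induction i with
    | zero => simp
    | succ i ih =>
      have step : ∑ k ∈ Finset.range i, (s (k + 1) - s k) * (b (i + 1) - b (k + 1)) =
          ∑ k ∈ Finset.range i, (s (k + 1) - s k) * (b i - b (k + 1)) +
            (s i - s 0) * (b (i + 1) - b i) := by
        rw [← Finset.sum_range_sub s, Finset.sum_mul, ← Finset.sum_add_distrib]
        exact Finset.sum_congr rfl fun k _ => by ring
      rw [Finset.sum_range_succ, step]
      linear_combination ih - hs i
  rw [truncated i]
  congr 1
  have hsub : Finset.range i ⊆ Finset.range n := Finset.range_subset_range.2 hi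
  rw [← Finset.sum_subset hsub fun k _ hk => ?_]
  · refine Finset.sum_congr rfl fun k hk => ?_
    rw [max_eq_left]
    exact sub_nonneg.2 (hb.monotone (Finset.mem_range.1 hk))
  · rw [max_eq_right, mul_zero]
    have : i ≤ k + 1 := by rw [Finset.mem_range] at hk; omega
    exact sub_nonpos.2 (hb.monotone this)

/-- A signed weight without mass and barycentre that is nonpositive on ramps is nonnegative on
functions of decreasing slope. -/
lemma sum_mul_nonneg_of_sum_mul_ramp_nonpos {b : ℕ → ℝ} (hb : StrictMono b) {n : ℕ}
    {d g s : ℕ → ℝ} (hs : ∀ k, s k * (b (k + 1) - b k) = g (k + 1) - g k)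
    (hconc : ∀ k, k + 2 ≤ n → s (k + 1) ≤ s k)
    (hmass : ∑ i ∈ Finset.range (n + 1), d i = 0)
    (hmean : ∑ i ∈ Finset.range (n + 1), d i * b i = 0)
    (hramp : ∀ k, ∑ i ∈ Finset.range (n + 1), d i * max (b i - b k) 0 ≤ 0) :
    0 ≤ ∑ i ∈ Finset.range (n + 1), d i * g i := by
  have expand : ∑ i ∈ Finset.range (n + 1), d i * g i =
      (g 0 - s 0 * b 0) * ∑ i ∈ Finset.range (n + 1), d i +
      s 0 * ∑ i ∈ Finset.range (n + 1), d i * b i +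
      ∑ k ∈ Finset.range n, (s (k + 1) - s k) *
        ∑ i ∈ Finset.range (n + 1), d i * max (b i - b (k + 1)) 0 := by
    simp_rw [Finset.mul_sum]
    rw [Finset.sum_comm (s := Finset.range n), ← Finset.sum_add_distrib, ← Finset.sum_add_distrib]
    refine Finset.sum_congr rfl fun i hi => ?_
    have hin : i ≤ n := Nat.lt_succ_iff.1 (Finset.mem_range.1 hi)
    nth_rewrite 1 [eq_affine_add_sum_ramps hb g s hs hin]
    rw [mul_add, Finset.mul_sum]
    congr 1
    · ring
    · exact Finset.sum_congr rfl fun k _ => by ring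
  rw [expand, hmass, hmean, mul_zero, mul_zero, zero_add, zero_add]
  refine Finset.sum_nonneg fun k hk => ?_
  rw [Finset.mem_range] at hk
  rcases Nat.lt_or_ge (k + 1) n with h | h
  · exact mul_nonneg_of_nonpos_of_nonpos (sub_nonpos.2 (hconc k h)) (hramp _)
  · rw [Finset.sum_eq_zero, mul_zero]
    intro i hi
    rw [Finset.mem_range] at hi
    rw [max_eq_right, mul_zero]
    exact sub_nonpos.2 (hb.monotone (by omega))

/-- Probability vectors on `b 0, …, b n` with a given barycentre. -/
def barycentricWeights (b : ℕ → ℝ) (n : ℕ) (t : ℝ) : Set (Fin (n + 1) → ℝ) :=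
  {p | (∀ j, 0 ≤ p j) ∧ ∑ j, p j = 1 ∧ ∑ j, p j * b j = t}

lemma isCompact_barycentricWeights (b : ℕ → ℝ) (n : ℕ) (t : ℝ) :
    IsCompact (barycentricWeights b n t) := by
  have hbox : IsCompact (Set.univ.pi fun _ : Fin (n + 1) => Set.Icc (0 : ℝ) 1) :=
    isCompact_univ_pi fun _ => isCompact_Icc
  refine hbox.of_isClosed_subset ?_ ?_
  · simp only [barycentricWeights, Set.ofPred_and, Set.ofPred_forall]
    refine IsClosed.inter (isClosed_iInter fun j => isClosed_le (by fun_prop) (by fun_prop)) ?_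
    exact (isClosed_eq (by fun_prop) (by fun_prop)).inter
      (isClosed_eq (by fun_prop) (by fun_prop))
  · rintro p ⟨h0, h1, -⟩ j -
    refine ⟨h0 j, ?_⟩
    rw [← h1]
    exact Finset.single_le_sum (fun i _ => h0 i) (Finset.mem_univ j)

lemma combo_mem_barycentricWeights {b : ℕ → ℝ} {n : ℕ} {t t' α β : ℝ} {p p' : Fin (n + 1) → ℝ}
    (hp : p ∈ barycentricWeights b n t) (hp' : p' ∈ barycentricWeights b n t')
    (hα : 0 ≤ α) (hβ : 0 ≤ β) (hαβ : α + β = 1) :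
    α • p + β • p' ∈ barycentricWeights b n (α * t + β * t') := by
  obtain ⟨h0, h1, h2⟩ := hp
  obtain ⟨h0', h1', h2'⟩ := hp'
  refine ⟨fun j => add_nonneg (mul_nonneg hα (h0 j)) (mul_nonneg hβ (h0' j)), ?_, ?_⟩
  · simp [Finset.sum_add_distrib, ← Finset.mul_sum, h1, h1', hαβ]
  · simp [add_mul, mul_assoc, Finset.sum_add_distrib, ← Finset.mul_sum, h2, h2']

lemma convex_barycentricWeights (b : ℕ → ℝ) (n : ℕ) (t : ℝ) :
    Convex ℝ (barycentricWeights b n t) := by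
  intro p hp p' hp' α β hα hβ hαβ
  have := combo_mem_barycentricWeights hp hp' hα hβ hαβ
  rwa [← add_mul, hαβ, one_mul] at this

lemma single_mem_barycentricWeights (b : ℕ → ℝ) {n : ℕ} (i : Fin (n + 1)) :
    Pi.single i 1 ∈ barycentricWeights b n (b i) := by
  refine ⟨fun j => ?_, by simp, by simp [Pi.single_apply]⟩
  by_cases h : j = i <;> simp [h]

/-- Strassen's theorem on finitely many points of the line: weights that increase in the convex
order are linked by a martingale matrix. -/
theorem exists_martingale_matrix {b : ℕ → ℝ} (hb : StrictMono b) {n : ℕ} {m ν : ℕ → ℝ}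
    (hν : ∀ i, 0 ≤ ν i)
    (hmass : ∑ i ∈ Finset.range (n + 1), m i = ∑ i ∈ Finset.range (n + 1), ν i)
    (hmean : ∑ i ∈ Finset.range (n + 1), m i * b i = ∑ i ∈ Finset.range (n + 1), ν i * b i)
    (hramp : ∀ k, ∑ i ∈ Finset.range (n + 1), m i * max (b i - b k) 0 ≤
      ∑ i ∈ Finset.range (n + 1), ν i * max (b i - b k) 0) :
    ∃ P : Fin (n + 1) → Fin (n + 1) → ℝ, (∀ i : Fin (n + 1), P i ∈ barycentricWeights b n (b i)) ∧
      ∀ j : Fin (n + 1), ∑ i : Fin (n + 1), m i * P i j = ν j := by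
  let push : (Fin (n + 1) → Fin (n + 1) → ℝ) →ₗ[ℝ] (Fin (n + 1) → ℝ) :=
    ∑ i : Fin (n + 1), m i • LinearMap.proj i
  have push_apply : ∀ P, push P = ∑ i : Fin (n + 1), m i • P i := fun P => by simp [push]
  let rows : Set (Fin (n + 1) → Fin (n + 1) → ℝ) :=
    Set.univ.pi fun i : Fin (n + 1) => barycentricWeights b n (b i)
  have rows_compact : IsCompact rows :=
    isCompact_univ_pi fun i => isCompact_barycentricWeights b n (b i)
  have rows_convex : Convex ℝ rows := convex_pi fun i _ => convex_barycentricWeights b n (b i)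
  by_cases hmem : (fun j : Fin (n + 1) => ν j) ∈ push '' rows
  · obtain ⟨P, hP, hPν⟩ := hmem
    refine ⟨P, fun i => hP i (Set.mem_univ i), fun j => ?_⟩
    have := congrFun hPν j
    rw [push_apply] at this
    simpa using this
  exfalso
  obtain ⟨F, u, hF, hu⟩ := geometric_hahn_banach_closed_point (rows_convex.linear_image push)
    (rows_compact.image push.continuous_of_finiteDimensional).isClosed hmem
  have best_row : ∀ i : ℕ, ∃ R : Fin (n + 1) → ℝ, i ≤ n → R ∈ barycentricWeights b n (b i) ∧
      ∀ p ∈ barycentricWeights b n (b i), F p ≤ F R := by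
    intro i
    by_cases hi : i ≤ n
    · obtain ⟨R, hR, hmax⟩ := (isCompact_barycentricWeights b n (b i)).exists_isMaxOn
        ⟨_, single_mem_barycentricWeights b ⟨i, Nat.lt_succ_of_le hi⟩⟩ F.continuous.continuousOn
      exact ⟨R, fun _ => ⟨hR, fun p hp => hmax hp⟩⟩
    · exact ⟨0, fun h => absurd h hi⟩
  choose R hR using best_row
  let g : ℕ → ℝ := fun i => F (R i)
  let s : ℕ → ℝ := fun k => (g (k + 1) - g k) / (b (k + 1) - b k)
  have gap : ∀ k, 0 < b (k + 1) - b k := fun k => sub_pos.2 (hb (Nat.lt_succ_self k))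
  have hs : ∀ k, s k * (b (k + 1) - b k) = g (k + 1) - g k := fun k =>
    div_mul_cancel₀ _ (gap k).ne'
  have hconc : ∀ k, k + 2 ≤ n → s (k + 1) ≤ s k := by
    intro k hk
    have gap₀ := gap k
    have gap₁ := gap (k + 1)
    have total : 0 < b (k + 2) - b k := by linarith
    have hcombo := combo_mem_barycentricWeights (hR k (by omega)).1 (hR (k + 2) hk).1
      (α := (b (k + 2) - b (k + 1)) / (b (k + 2) - b k))
      (β := (b (k + 1) - b k) / (b (k + 2) - b k))
      (div_nonneg gap₁.le total.le) (div_nonneg gap₀.le total.le) (by field_simp; ring)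
    have hcentre : (b (k + 2) - b (k + 1)) / (b (k + 2) - b k) * b k +
        (b (k + 1) - b k) / (b (k + 2) - b k) * b (k + 2) = b (k + 1) := by
      field_simp; ring
    rw [hcentre] at hcombo
    have hle := (hR (k + 1) (by omega)).2 _ hcombo
    rw [map_add, map_smul, map_smul, smul_eq_mul, smul_eq_mul, div_mul_eq_mul_div,
      div_mul_eq_mul_div, ← add_div, div_le_iff₀ total] at hle
    change (b (k + 2) - b (k + 1)) * g k + (b (k + 1) - b k) * g (k + 2) ≤
      g (k + 1) * (b (k + 2) - b k) at hle
    change (g (k + 2) - g (k + 1)) / (b (k + 2) - b (k + 1)) ≤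
      (g (k + 1) - g k) / (b (k + 1) - b k)
    rw [div_le_div_iff₀ gap₁ gap₀]
    linarith
  have order := sum_mul_nonneg_of_sum_mul_ramp_nonpos hb (d := fun i => m i - ν i) hs hconc
    (by simp [hmass]) (by simp [sub_mul, hmean])
    (fun k => by simpa [sub_mul] using hramp k)
  simp only [sub_mul, Finset.sum_sub_distrib, sub_nonneg] at order
  have hm : ∑ i ∈ Finset.range (n + 1), m i * g i < u := by
    have := hF _ ⟨fun i : Fin (n + 1) => R i,
      fun i _ => (hR i (Nat.lt_succ_iff.1 i.2)).1, push_apply _⟩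
    rw [map_sum] at this
    simpa [← Fin.sum_univ_eq_sum_range (fun i => m i * g i), g] using this
  have hνg : F (fun j : Fin (n + 1) => ν j) ≤ ∑ i ∈ Finset.range (n + 1), ν i * g i := by
    have hdecomp : (fun j : Fin (n + 1) => ν j) =
        ∑ i : Fin (n + 1), ν i • (Pi.single i 1 : Fin (n + 1) → ℝ) := by
      ext j
      simp [Pi.single_apply]
    rw [hdecomp, map_sum, ← Fin.sum_univ_eq_sum_range (fun i => ν i * g i)]
    refine Finset.sum_le_sum fun i _ => ?_
    rw [map_smul, smul_eq_mul]
    exact mul_le_mul_of_nonneg_left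
      ((hR i (Nat.lt_succ_iff.1 i.2)).2 _ (single_mem_barycentricWeights b i)) (hν i)
  linarith

/-- Every finite set of reals is an initial segment of a strictly increasing sequence. -/
lemma exists_strictMono_image_range_eq (S : Finset ℝ) :
    ∃ (n : ℕ) (b : ℕ → ℝ), StrictMono b ∧ (Finset.range n).image b = S := by
  induction S using Finset.induction_on_max with
  | empty => exact ⟨0, fun k => k, Nat.strictMono_cast, by simp⟩
  | insert x S hx ih =>
    obtain ⟨n, b, hb, rfl⟩ := ih
    refine ⟨n + 1, fun k => if k < n then b k else x + ((k : ℝ) - n),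
      strictMono_nat_of_lt_succ fun k => ?_, ?_⟩
    · rcases lt_trichotomy (k + 1) n with h | h | h
      · rw [if_pos h, if_pos (by omega)]
        exact hb (Nat.lt_succ_self k)
      · subst h
        rw [if_neg (lt_irrefl _), if_pos (Nat.lt_succ_self k)]
        simpa using hx (b k) (Finset.mem_image_of_mem b (Finset.mem_range.2 (by omega)))
      · rw [if_neg (by omega), if_neg (by omega)]
        push_cast
        linarith
    · rw [Finset.range_add_one, Finset.image_insert]
      simp only [lt_irrefl, if_false, sub_self, add_zero]
      congr 1
      exact Finset.image_congr fun k hk => if_pos (Finset.mem_range.1 hk)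

/-- Measurable weights splitting each `t ∈ [b 0, b n]` between its two neighbours among
`b 0, …, b n`. -/
lemma exists_hat_weights {b : ℕ → ℝ} (hb : StrictMono b) {n : ℕ} (hn : 0 < n) :
    ∃ q : ℕ → ℝ → ℝ, (∀ j, Measurable (q j)) ∧ ∀ t ∈ Set.Icc (b 0) (b n),
      (∀ j, 0 ≤ q j t ∧ q j t ≤ 1) ∧ ∑ j ∈ Finset.range (n + 1), q j t = 1 ∧
      ∑ j ∈ Finset.range (n + 1), q j t * b j = t ∧
      ∀ k, ∑ j ∈ Finset.range (n + 1), q j t * max (b j - b k) 0 = max (t - b k) 0 := by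
  classical
  let cell : ℝ → ℕ := fun t => Nat.findGreatest (fun k => b k ≤ t) (n - 1)
  have cell_meas : Measurable cell := measurable_findGreatest fun k _ => measurableSet_Ici
  let s : ℝ → ℝ := fun t => (t - b (cell t)) / (b (cell t + 1) - b (cell t))
  have s_meas : Measurable s := by
    have h₀ : Measurable fun t => b (cell t) := (measurable_from_nat (f := b)).comp cell_meas
    have h₁ : Measurable fun t => b (cell t + 1) :=
      (measurable_from_nat (f := fun k => b (k + 1))).comp cell_meas
    exact (measurable_id.sub h₀).div (h₁.sub h₀)
  refine ⟨fun j t => (if j = cell t then 1 - s t else 0) + if j = cell t + 1 then s t else 0,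
    fun j => ?_, fun t ht => ?_⟩
  · refine (Measurable.ite ?_ (measurable_const.sub s_meas) measurable_const).add
      (Measurable.ite ?_ s_meas measurable_const)
    · exact measurableSet_eq_fun measurable_const cell_meas
    · exact measurableSet_eq_fun measurable_const (cell_meas.add_const 1)
  have cell_lt : cell t < n := by
    have : cell t ≤ n - 1 := Nat.findGreatest_le _
    omega
  have cell_le : b (cell t) ≤ t :=
    Nat.findGreatest_spec (P := fun k => b k ≤ t) (Nat.zero_le (n - 1)) ht.1
  have le_next : t ≤ b (cell t + 1) := by
    rcases Nat.lt_or_ge (cell t + 1) n with h | h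
    · exact (not_le.1 (Nat.findGreatest_is_greatest (P := fun k => b k ≤ t) (n := n - 1)
        (Nat.lt_succ_self (cell t)) (by omega))).le
    · exact ht.2.trans (hb.monotone h)
  have gap : 0 < b (cell t + 1) - b (cell t) := sub_pos.2 (hb (Nat.lt_succ_self _))
  have s_nonneg : 0 ≤ s t := div_nonneg (sub_nonneg.2 cell_le) gap.le
  have s_le : s t ≤ 1 := (div_le_one gap).2 (by linarith)
  have s_mul : s t * (b (cell t + 1) - b (cell t)) = t - b (cell t) := div_mul_cancel₀ _ gap.ne'
  have collapse : ∀ f : ℕ → ℝ, ∑ j ∈ Finset.range (n + 1),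
      ((if j = cell t then 1 - s t else 0) + if j = cell t + 1 then s t else 0) * f j =
        (1 - s t) * f (cell t) + s t * f (cell t + 1) := by
    intro f
    simp only [add_mul, ite_mul, zero_mul, Finset.sum_add_distrib, Finset.sum_ite_eq',
      Finset.mem_range]
    rw [if_pos (by omega), if_pos (by omega)]
  refine ⟨fun j => ?_, ?_, ?_, fun k => ?_⟩
  · dsimp only
    split_ifs <;> first | omega | constructor <;> linarith
  · simpa using collapse fun _ => 1
  · rw [collapse]
    linarith
  · rw [collapse fun j => max (b j - b k) 0]
    rcases Nat.lt_or_ge (cell t) k with h | h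
    · have h₁ : b (cell t + 1) ≤ b k := hb.monotone h
      rw [max_eq_right, max_eq_right, max_eq_right] <;> linarith
    · have h₀ : b k ≤ b (cell t) := hb.monotone h
      rw [max_eq_left, max_eq_left, max_eq_left] <;> linarith

section Kernels

variable {X : Type*} [MeasurableSpace X] {μ : Measure X}

lemma IsBistochastic.comp_const {κ : Kernel X X} (hκ : IsBistochastic μ κ) :
    (κ ∘ₖ Kernel.const Unit μ) () = μ := by
  ext A hA
  rw [Kernel.comp_apply' _ _ _ hA]
  exact hκ.2 A hA

lemma IsBistochastic.integrable_kernApply {κ : Kernel X X} (hκ : IsBistochastic μ κ)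
    {f : X → ℝ} (hf : Integrable f μ) : Integrable (kernApply κ f) μ := by
  rw [← hκ.comp_const] at hf
  exact hf.integral_comp

lemma IsBistochastic.integral_kernApply {κ : Kernel X X} (hκ : IsBistochastic μ κ)
    {f : X → ℝ} (hf : Integrable f μ) : ∫ x, kernApply κ f x ∂μ = ∫ x, f x ∂μ := by
  rw [← hκ.comp_const] at hf
  have h := Kernel.integral_comp hf
  rw [hκ.comp_const, Kernel.const_apply] at h
  exact h.symm

lemma IsBistochastic.ae_integrable {κ : Kernel X X} (hκ : IsBistochastic μ κ)
    {f : X → ℝ} (hf : Integrable f μ) : ∀ᵐ x ∂μ, Integrable f (κ x) := by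
  rw [← hκ.comp_const] at hf
  exact hf.ae_of_comp

lemma MeasureTheory.Integrable.ramp [IsFiniteMeasure μ] {f : X → ℝ} (hf : Integrable f μ) (c : ℝ) :
    Integrable (fun x => max (f x - c) 0) μ :=
  (hf.sub (integrable_const c)).pos_part

lemma IsBistochastic.integral_ramp_kernApply_le [IsFiniteMeasure μ] {κ : Kernel X X}
    (hκ : IsBistochastic μ κ) {f : X → ℝ} (hf : Integrable f μ) (c : ℝ) :
    ∫ x, max (kernApply κ f x - c) 0 ∂μ ≤ ∫ x, max (f x - c) 0 ∂μ := by
  have := hκ.1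
  rw [← hκ.integral_kernApply (hf.ramp c)]
  refine integral_mono_ae ((hκ.integrable_kernApply hf).ramp c)
    (hκ.integrable_kernApply (hf.ramp c)) ?_
  filter_upwards [hκ.ae_integrable hf] with x hx
  refine max_le ?_ (integral_nonneg fun y => le_max_right _ _)
  have hc : kernApply κ f x - c = ∫ y, (f y - c) ∂κ x := by
    rw [integral_sub hx (integrable_const c)]
    simp [kernApply]
  rw [hc]
  exact integral_mono (hx.sub (integrable_const c)) (hx.ramp c) fun y => le_max_left _ _

/-- A family of densities with the masses of a partition into level sets yields a bistochastic
kernel. -/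
lemma exists_isBistochastic_of_weights [Nonempty X] [IsFiniteMeasure μ] {ι : Type*} [Fintype ι]
    {p : ι → X → ℝ} (hpm : ∀ j, Measurable (p j)) (hp0 : ∀ j x, 0 ≤ p j x)
    (hp1 : ∀ x, ∑ j, p j x = 1) (hpi : ∀ j, Integrable (p j) μ)
    {B : ι → Set X} (hB : ∀ j, MeasurableSet (B j))
    (hdisj : Pairwise fun i j => Disjoint (B i) (B j))
    (hcover : ∀ᵐ x ∂μ, ∃ j, x ∈ B j) (hmass : ∀ j, ∫ x, p j x ∂μ = μ.real (B j))
    {f : X → ℝ} {v : ι → ℝ} (hv : ∀ j, ∀ x ∈ B j, f x = v j) :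
    ∃ κ : Kernel X X, IsBistochastic μ κ ∧ ∀ᵐ x ∂μ, kernApply κ f x = ∑ j, p j x * v j := by
  classical
  obtain ⟨x₀⟩ := ‹Nonempty X›
  let π : ι → Measure X := fun j => if μ (B j) = 0 then Measure.dirac x₀ else μ[|B j]
  have π_prob : ∀ j, IsProbabilityMeasure (π j) := by
    intro j
    by_cases h : μ (B j) = 0
    · simp only [π, if_pos h]
      infer_instance
    · simp only [π, if_neg h]
      exact cond_isProbabilityMeasure h
  have apply_eq : ∀ x (A : Set X), (∑ j, ENNReal.ofReal (p j x) • π j) A =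
      ∑ j, ENNReal.ofReal (p j x) * π j A := fun x A => by simp
  have weight_meas : ∀ (A : Set X) (j : ι), Measurable fun x => ENNReal.ofReal (p j x) * π j A :=
    fun A j => (hpm j).ennreal_ofReal.mul_const _
  let κ : Kernel X X :=
    ⟨fun x => ∑ j, ENNReal.ofReal (p j x) • π j, by
      refine Measure.measurable_of_measurable_coe _ fun A _ => ?_
      simp only [apply_eq]
      exact Finset.measurable_sum _ fun j _ => weight_meas A j⟩
  have κ_eq : ∀ x, κ x = ∑ j, ENNReal.ofReal (p j x) • π j := fun _ => rfl
  refine ⟨κ, ⟨⟨fun x => ⟨?_⟩⟩, fun A hA => ?_⟩, ?_⟩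
  · rw [κ_eq, apply_eq]
    simp only [measure_univ, mul_one]
    rw [← ENNReal.ofReal_sum_of_nonneg fun j _ => hp0 j x, hp1, ENNReal.ofReal_one]
  · simp only [κ_eq, apply_eq]
    rw [lintegral_finsetSum _ fun j _ => weight_meas A j]
    have piece : ∀ j, ∫⁻ x, ENNReal.ofReal (p j x) * π j A ∂μ = μ (B j ∩ A) := by
      intro j
      rw [lintegral_mul_const _ (hpm j).ennreal_ofReal,
        ← ofReal_integral_eq_lintegral_ofReal (hpi j) (Filter.Eventually.of_forall (hp0 j)),
        hmass, ofReal_measureReal]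
      by_cases h : μ (B j) = 0
      · rw [h, zero_mul, measure_mono_null Set.inter_subset_left h]
      · simp only [π, if_neg h]
        rw [mul_comm, cond_mul_eq_inter (hB j)]
    simp only [piece]
    rw [← measure_biUnion_finset (fun i _ j _ hij =>
      (hdisj hij).mono Set.inter_subset_left Set.inter_subset_left) fun j _ => (hB j).inter hA]
    refine measure_congr ?_
    filter_upwards [hcover] with x hx
    refine propext ⟨fun h => ?_, fun h => ?_⟩
    · obtain ⟨j, -, hj⟩ := Set.mem_iUnion₂.1 h
      exact hj.2
    · obtain ⟨j, hj⟩ := hx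
      exact Set.mem_iUnion₂.2 ⟨j, Finset.mem_univ j, hj, h⟩
  · have vanish : ∀ᵐ x ∂μ, ∀ j, μ (B j) = 0 → p j x = 0 := by
      refine ae_all_iff.2 fun j => ?_
      by_cases h : μ (B j) = 0
      · have hz : ∫ x, p j x ∂μ = 0 := by rw [hmass, Measure.real, h, ENNReal.toReal_zero]
        filter_upwards [(integral_eq_zero_iff_of_nonneg (hp0 j) (hpi j)).1 hz] with x hx _ using hx
      · exact Filter.Eventually.of_forall fun x hx => absurd hx h
    filter_upwards [vanish] with x hx
    have level : ∀ j, μ (B j) ≠ 0 → f =ᵐ[π j] fun _ => v j := by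
      intro j h
      simp only [π, if_neg h]
      filter_upwards [ae_cond_mem (hB j)] with y hy using hv j y hy
    rw [kernApply, κ_eq, integral_finsetSum_measure]
    · refine Finset.sum_congr rfl fun j _ => ?_
      rw [integral_smul_measure, ENNReal.toReal_ofReal (hp0 j x), smul_eq_mul]
      by_cases h : μ (B j) = 0
      · rw [hx j h, zero_mul, zero_mul]
      · rw [integral_congr_ae (level j h)]
        simp
    · intro j _
      by_cases h : μ (B j) = 0
      · simp [hx j h]
      · exact ((integrable_const (v j)).congr (level j h).symm).smul_measure ENNReal.ofReal_ne_top

lemma integral_comp_eq_sum_levels [IsFiniteMeasure μ] {f : X → ℝ} (hf : Measurable f)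
    {b : ℕ → ℝ} (hb : StrictMono b) {n : ℕ} (hval : ∀ᵐ x ∂μ, ∃ j < n, f x = b j) (F : ℝ → ℝ) :
    ∫ x, F (f x) ∂μ = ∑ j ∈ Finset.range n, μ.real (f ⁻¹' {b j}) * F (b j) := by
  have level_meas : ∀ j, MeasurableSet (f ⁻¹' {b j}) := fun j => hf (measurableSet_singleton _)
  have hsum : (fun x => F (f x)) =ᵐ[μ]
      fun x => ∑ j ∈ Finset.range n, (f ⁻¹' {b j}).indicator (fun _ => F (b j)) x := by
    filter_upwards [hval] with x hx
    obtain ⟨j, hj, hxj⟩ := hx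
    rw [Finset.sum_eq_single_of_mem j (Finset.mem_range.2 hj)]
    · simp [hxj]
    · intro k _ hk
      refine Set.indicator_of_notMem ?_ _
      simp only [Set.mem_preimage, Set.mem_singleton_iff, hxj]
      exact fun h => hk (hb.injective h).symm
  rw [integral_congr_ae hsum, integral_finsetSum _ fun j _ =>
    (integrable_const _).indicator (level_meas j)]
  refine Finset.sum_congr rfl fun j _ => ?_
  rw [integral_indicator_const _ (level_meas j), smul_eq_mul]

/-- A function dominated in the convex order by a finitely valued one is its image under a
bistochastic kernel. -/
theorem exists_isBistochastic_of_convex_order [Nonempty X] [IsFiniteMeasure μ] {f g : X → ℝ}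
    (hf : Integrable f μ) (hg : Measurable g) {S : Finset ℝ} (hS : S.Nonempty)
    (hval : ∀ᵐ x ∂μ, g x ∈ S) (hbd : ∀ᵐ x ∂μ, S.min' hS ≤ f x ∧ f x ≤ S.max' hS)
    (hmean : ∫ x, f x ∂μ = ∫ x, g x ∂μ)
    (hramp : ∀ c : ℝ, ∫ x, max (f x - c) 0 ∂μ ≤ ∫ x, max (g x - c) 0 ∂μ) :
    ∃ κ : Kernel X X, IsBistochastic μ κ ∧ f =ᵐ[μ] kernApply κ g := by
  obtain ⟨n, b, hb, hbS⟩ := exists_strictMono_image_range_eq S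
  have mem_S : ∀ t ∈ S, ∃ j < n, b j = t := fun t ht => by
    simpa [← hbS] using ht
  obtain ⟨jmin, hjmin, hmin⟩ := mem_S _ (S.min'_mem hS)
  obtain ⟨jmax, hjmax, hmax⟩ := mem_S _ (S.max'_mem hS)
  have hn : 0 < n := by omega
  have levels : ∀ᵐ x ∂μ, ∃ j < n + 1, g x = b j := by
    filter_upwards [hval] with x hx
    obtain ⟨j, hj, hjx⟩ := mem_S _ hx
    exact ⟨j, by omega, hjx.symm⟩
  let h : X → ℝ := fun x => max (b 0) (min (b n) (hf.1.mk f x))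
  have h_meas : Measurable h :=
    measurable_const.max (measurable_const.min hf.1.stronglyMeasurable_mk.measurable)
  have h_mem : ∀ x, h x ∈ Set.Icc (b 0) (b n) := fun x =>
    ⟨le_max_left _ _, max_le (hb.monotone (Nat.zero_le n)) (min_le_left _ _)⟩
  have h_eq : f =ᵐ[μ] h := by
    filter_upwards [hbd, hf.1.ae_eq_mk] with x hx hmk
    have h₀ : b 0 ≤ f x := (hb.monotone (Nat.zero_le jmin)).trans (hmin.le.trans hx.1)
    have h₁ : f x ≤ b n := (hx.2.trans hmax.ge).trans (hb.monotone hjmax.le)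
    simp only [h]
    rw [← hmk, min_eq_right h₁, max_eq_right h₀]
  obtain ⟨q, q_meas, hq⟩ := exists_hat_weights hb hn
  have qh_meas : ∀ j, Measurable fun x => q j (h x) := fun j => (q_meas j).comp h_meas
  have qh_int : ∀ j, Integrable (fun x => q j (h x)) μ := fun j =>
    Integrable.of_bound (qh_meas j).aestronglyMeasurable 1 (Filter.Eventually.of_forall fun x => by
      obtain ⟨h₀, h₁⟩ := (hq _ (h_mem x)).1 j
      rwa [Real.norm_of_nonneg h₀])
  have push : ∀ F : ℝ → ℝ, ∑ j ∈ Finset.range (n + 1), (∫ x, q j (h x) ∂μ) * F (b j) =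
      ∫ x, ∑ j ∈ Finset.range (n + 1), q j (h x) * F (b j) ∂μ := by
    intro F
    rw [integral_finsetSum _ fun j _ => (qh_int j).mul_const _]
    simp only [integral_mul_const]
  have level_sum := integral_comp_eq_sum_levels hg hb levels
  obtain ⟨P, hP, hPν⟩ := exists_martingale_matrix hb (n := n)
    (m := fun j => ∫ x, q j (h x) ∂μ) (ν := fun j => μ.real (g ⁻¹' {b j}))
    (fun j => measureReal_nonneg)
    (by
      have h₁ := push fun _ => 1
      have h₂ := level_sum fun _ => 1
      simp only [mul_one] at h₁ h₂
      rw [h₁, ← h₂]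
      exact integral_congr_ae (Filter.Eventually.of_forall fun x => (hq _ (h_mem x)).2.1))
    (by
      rw [push fun t => t, ← level_sum fun t => t, ← hmean, integral_congr_ae h_eq]
      exact integral_congr_ae (Filter.Eventually.of_forall fun x => (hq _ (h_mem x)).2.2.1))
    (fun k => by
      rw [push fun t => max (t - b k) 0, ← level_sum fun t => max (t - b k) 0]
      refine le_trans (le_of_eq (integral_congr_ae ?_)) (hramp (b k))
      filter_upwards [h_eq] with x hx
      rw [(hq _ (h_mem x)).2.2.2 k, hx])
  have collapse : ∀ (x : X) (F : Fin (n + 1) → ℝ),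
      ∑ j, (∑ i : Fin (n + 1), q i (h x) * P i j) * F j =
        ∑ i : Fin (n + 1), q i (h x) * ∑ j, P i j * F j := by
    intro x F
    simp only [Finset.sum_mul, Finset.mul_sum, mul_assoc]
    exact Finset.sum_comm
  obtain ⟨κ, hκ, hκg⟩ := exists_isBistochastic_of_weights (μ := μ)
    (p := fun (j : Fin (n + 1)) x => ∑ i : Fin (n + 1), q i (h x) * P i j)
    (B := fun j : Fin (n + 1) => g ⁻¹' {b j}) (f := g) (v := fun j => b j)
    (fun j => Finset.measurable_sum _ fun i _ => (qh_meas i).mul_const _)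
    (fun j x => Finset.sum_nonneg fun i _ =>
      mul_nonneg ((hq _ (h_mem x)).1 i).1 ((hP i).1 j))
    (fun x => by
      have hx := collapse x fun _ => 1
      simp only [mul_one, (hP _).2.1] at hx
      rw [hx, Fin.sum_univ_eq_sum_range fun i => q i (h x)]
      exact (hq _ (h_mem x)).2.1)
    (fun j => integrable_finsetSum _ fun i _ => (qh_int i).mul_const _)
    (fun j => hg (measurableSet_singleton _))
    (fun i j hij => by
      refine Disjoint.preimage g (Set.disjoint_singleton.2 fun he => hij ?_)
      exact Fin.ext (hb.injective he))
    (by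
      filter_upwards [levels] with x hx
      obtain ⟨j, hj, hjx⟩ := hx
      exact ⟨⟨j, hj⟩, hjx⟩)
    (fun j => by
      rw [integral_finsetSum _ fun (i : Fin (n + 1)) _ => (qh_int i).mul_const (P i j)]
      simp only [integral_mul_const]
      exact hPν j)
    (fun j x hx => hx)
  refine ⟨κ, hκ, ?_⟩
  filter_upwards [h_eq, hκg] with x hx hxκ
  rw [hxκ, collapse x fun j => b j, hx]
  simp only [(hP _).2.2]
  rw [Fin.sum_univ_eq_sum_range fun i => q i (h x) * b i]
  exact (hq _ (h_mem x)).2.2.1.symm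

/-- Domination on the ramps at the values of `g`, together with equality of means, confines `f` to
the range of `g`. -/
lemma ae_mem_Icc_of_ramp_le [IsFiniteMeasure μ] {f g : X → ℝ} (hf : Integrable f μ)
    (hg : Integrable g μ) {S : Finset ℝ} (hS : S.Nonempty) (hval : ∀ᵐ x ∂μ, g x ∈ S)
    (hmean : ∫ x, f x ∂μ = ∫ x, g x ∂μ)
    (hramp : ∀ c ∈ S, ∫ x, max (f x - c) 0 ∂μ ≤ ∫ x, max (g x - c) 0 ∂μ) :
    ∀ᵐ x ∂μ, S.min' hS ≤ f x ∧ f x ≤ S.max' hS := by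
  have upper : (fun x => max (f x - S.max' hS) 0) =ᵐ[μ] 0 := by
    refine (integral_eq_zero_iff_of_nonneg (fun x => le_max_right _ _) (hf.ramp _)).1 ?_
    refine le_antisymm ((hramp _ (S.max'_mem hS)).trans (le_of_eq ?_))
      (integral_nonneg fun x => le_max_right _ _)
    refine integral_eq_zero_of_ae ?_
    filter_upwards [hval] with x hx
    exact max_eq_right (sub_nonpos.2 (S.le_max' _ hx))
  have hf_sub : Integrable (fun x => f x - S.min' hS) μ := hf.sub (integrable_const _)
  have lower : (fun x => max (f x - S.min' hS) 0 - (f x - S.min' hS)) =ᵐ[μ] 0 := by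
    refine (integral_eq_zero_iff_of_nonneg (fun x => sub_nonneg.2 (le_max_left _ _))
      ((hf.ramp _).sub hf_sub)).1 ?_
    refine le_antisymm ?_ (integral_nonneg fun x => sub_nonneg.2 (le_max_left _ _))
    rw [integral_sub (hf.ramp _) hf_sub, sub_nonpos]
    refine (hramp _ (S.min'_mem hS)).trans (le_of_eq ?_)
    have hg_ramp : ∫ x, max (g x - S.min' hS) 0 ∂μ = ∫ x, (g x - S.min' hS) ∂μ := by
      refine integral_congr_ae ?_
      filter_upwards [hval] with x hx
      exact max_eq_left (sub_nonneg.2 (S.min'_le _ hx))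
    rw [hg_ramp, integral_sub hg (integrable_const _), integral_sub hf (integrable_const _), hmean]
  filter_upwards [upper, lower] with x hu hl
  simp only [Pi.zero_apply] at hu hl
  constructor
  · have := le_max_right (f x - S.min' hS) 0
    linarith
  · have := le_max_left (f x - S.max' hS) 0
    linarith

/-- Domination on the ramps at the values of `g` propagates to all ramps. -/
lemma integral_ramp_le_of_forall_mem [IsFiniteMeasure μ] {f g : X → ℝ} (hf : Integrable f μ)
    (hg : Integrable g μ) {S : Finset ℝ} (hS : S.Nonempty) (hval : ∀ᵐ x ∂μ, g x ∈ S)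
    (hmean : ∫ x, f x ∂μ = ∫ x, g x ∂μ)
    (hramp : ∀ c ∈ S, ∫ x, max (f x - c) 0 ∂μ ≤ ∫ x, max (g x - c) 0 ∂μ) (c : ℝ) :
    ∫ x, max (f x - c) 0 ∂μ ≤ ∫ x, max (g x - c) 0 ∂μ := by
  have hbd := ae_mem_Icc_of_ramp_le hf hg hS hval hmean hramp
  rcases le_or_gt c (S.min' hS) with hc | hc
  · have hf_ramp : ∫ x, max (f x - c) 0 ∂μ = ∫ x, (f x - c) ∂μ := by
      refine integral_congr_ae ?_
      filter_upwards [hbd] with x hx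
      exact max_eq_left (by linarith)
    rw [hf_ramp, integral_sub hf (integrable_const _), hmean,
      ← integral_sub hg (integrable_const _)]
    exact integral_mono (hg.sub (integrable_const _)) (hg.ramp c) fun x => le_max_left _ _
  rcases le_or_gt (S.max' hS) c with hc' | hc'
  · have hf_ramp : ∫ x, max (f x - c) 0 ∂μ = 0 := by
      refine integral_eq_zero_of_ae ?_
      filter_upwards [hbd] with x hx
      exact max_eq_right (by linarith)
    rw [hf_ramp]
    exact integral_nonneg fun x => le_max_right _ _
  have below : (S.filter (· ≤ c)).Nonempty :=
    ⟨_, Finset.mem_filter.2 ⟨S.min'_mem hS, hc.le⟩⟩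
  have above : (S.filter (c < ·)).Nonempty :=
    ⟨_, Finset.mem_filter.2 ⟨S.max'_mem hS, hc'⟩⟩
  set l := (S.filter (· ≤ c)).max' below with hl
  set u := (S.filter (c < ·)).min' above with hu
  obtain ⟨l_mem, l_le⟩ := Finset.mem_filter.1 (Finset.max'_mem _ below)
  obtain ⟨u_mem, lt_u⟩ := Finset.mem_filter.1 (Finset.min'_mem _ above)
  rw [← hl] at l_mem l_le
  rw [← hu] at u_mem lt_u
  have gap : 0 < u - l := by linarith
  obtain ⟨s, hs⟩ : ∃ s, s = (c - l) / (u - l) := ⟨_, rfl⟩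
  have hs0 : 0 ≤ s := by rw [hs]; exact div_nonneg (by linarith) gap.le
  have hs1 : 0 ≤ 1 - s := by rw [hs, sub_nonneg, div_le_one gap]; linarith
  have hsc : s * (u - l) = c - l := by rw [hs]; exact div_mul_cancel₀ _ gap.ne'
  have split : ∀ {k : X → ℝ}, Integrable k μ →
      ∫ x, ((1 - s) * max (k x - l) 0 + s * max (k x - u) 0) ∂μ =
        (1 - s) * ∫ x, max (k x - l) 0 ∂μ + s * ∫ x, max (k x - u) 0 ∂μ := by
    intro k hk
    rw [integral_add ((hk.ramp l).const_mul _) ((hk.ramp u).const_mul _), integral_const_mul,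
      integral_const_mul]
  have hg_split : ∫ x, max (g x - c) 0 ∂μ =
      ∫ x, ((1 - s) * max (g x - l) 0 + s * max (g x - u) 0) ∂μ := by
    refine integral_congr_ae ?_
    filter_upwards [hval] with x hx
    rcases le_or_gt (g x) c with h | h
    · have : g x ≤ l := Finset.le_max' _ _ (Finset.mem_filter.2 ⟨hx, h⟩)
      rw [max_eq_right (by linarith), max_eq_right (by linarith), max_eq_right (by linarith)]
      ring
    · have : u ≤ g x := Finset.min'_le _ _ (Finset.mem_filter.2 ⟨hx, h⟩)
      rw [max_eq_left (by linarith), max_eq_left (by linarith), max_eq_left (by linarith)]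
      linear_combination hsc
  calc ∫ x, max (f x - c) 0 ∂μ
      ≤ ∫ x, ((1 - s) * max (f x - l) 0 + s * max (f x - u) 0) ∂μ := by
        refine integral_mono (hf.ramp c)
          (((hf.ramp l).const_mul _).add ((hf.ramp u).const_mul _)) fun x => ?_
        refine max_le ?_ (by positivity)
        have h₁ := mul_le_mul_of_nonneg_left (le_max_left (f x - l) 0) hs1
        have h₂ := mul_le_mul_of_nonneg_left (le_max_left (f x - u) 0) hs0
        linarith
    _ ≤ (1 - s) * ∫ x, max (g x - l) 0 ∂μ + s * ∫ x, max (g x - u) 0 ∂μ := by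
        rw [split hf]
        exact add_le_add (mul_le_mul_of_nonneg_left (hramp l l_mem) hs1)
          (mul_le_mul_of_nonneg_left (hramp u u_mem) hs0)
    _ = ∫ x, max (g x - c) 0 ∂μ := by rw [hg_split, split hg]

end Kernels

/-- characterization of the weak-* closure of the orbit of a finite
vortex-patch vorticity `ω₀ = Σᵢ aᵢ 𝟙_{Aᵢ}` by finitely many inequality constraints. -/
theorem patch_orbit_characterization
    (M : Set (ℝ × ℝ)) (hMopen : IsOpen M) (hMbdd : Bornology.IsBounded M)
    (N : ℕ) (hN : 0 < N) (a : Fin N → ℝ) (ha : Monotone a)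
    (A : Fin N → Set (ℝ × ℝ)) (hAmeas : ∀ i, MeasurableSet (A i))
    (hAdisj : ∀ i j, i ≠ j → Disjoint (A i) (A j))
    (hAcover : (⋃ i, A i) = M)
    (ω₀ : ℝ × ℝ → ℝ)
    (hω₀ : ω₀ = fun x => ∑ i : Fin N, (A i).indicator (fun _ => a i) x)
    (ω : ℝ × ℝ → ℝ) (hω : MemLp ω ⊤ (volume.restrict M)) :
    ((∃ κ : Kernel (ℝ × ℝ) (ℝ × ℝ), IsBistochastic (volume.restrict M) κ ∧
        ω =ᵐ[volume.restrict M] kernApply κ ω₀) ↔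
      ((∫ x, ω x ∂(volume.restrict M) = ∫ x, ω₀ x ∂(volume.restrict M)) ∧
        ∀ i : Fin N, ∫ x, max (ω x - a i) 0 ∂(volume.restrict M)
            ≤ ∫ x, max (ω₀ x - a i) 0 ∂(volume.restrict M))) ∧
    (((∫ x, ω x ∂(volume.restrict M) = ∫ x, ω₀ x ∂(volume.restrict M)) ∧
        ∀ i : Fin N, ∫ x, max (ω x - a i) 0 ∂(volume.restrict M)
            ≤ ∫ x, max (ω₀ x - a i) 0 ∂(volume.restrict M)) →
      ((∀ᵐ x ∂(volume.restrict M),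
          a ⟨0, hN⟩ ≤ ω x ∧ ω x ≤ a ⟨N - 1, Nat.sub_lt hN Nat.one_pos⟩) ∧
        ∀ c : ℝ, ∫ x, max (ω x - c) 0 ∂(volume.restrict M)
            ≤ ∫ x, max (ω₀ x - c) 0 ∂(volume.restrict M))) := by
  classical
  subst hω₀
  have vol_fin : IsFiniteMeasure (volume.restrict M) :=
    ⟨by rw [Measure.restrict_apply_univ]; exact hMbdd.measure_lt_top⟩
  set ω₀ : ℝ × ℝ → ℝ := fun x => ∑ i : Fin N, (A i).indicator (fun _ => a i) x with hω₀
  let S : Finset ℝ := Finset.univ.image a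
  have hS : S.Nonempty := ⟨a ⟨0, hN⟩, Finset.mem_image_of_mem a (Finset.mem_univ _)⟩
  have forall_S : ∀ {p : ℝ → Prop}, (∀ i, p (a i)) → ∀ c ∈ S, p c := by
    intro p hp c hc
    obtain ⟨i, -, rfl⟩ := Finset.mem_image.1 hc
    exact hp i
  have hmin : S.min' hS = a ⟨0, hN⟩ := by
    refine le_antisymm (S.min'_le _ (Finset.mem_image_of_mem a (Finset.mem_univ _))) ?_
    exact S.le_min' hS _ (forall_S fun i => ha (Fin.mk_le_of_le_val (Nat.zero_le i)))
  have hmax : S.max' hS = a ⟨N - 1, Nat.sub_lt hN Nat.one_pos⟩ := by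
    refine le_antisymm ?_ (S.le_max' _ (Finset.mem_image_of_mem a (Finset.mem_univ _)))
    exact S.max'_le hS _ (forall_S fun i => ha (Fin.le_def.2 (Nat.le_sub_one_of_lt i.2)))
  have ω₀_meas : Measurable ω₀ :=
    Finset.measurable_sum _ fun i _ => measurable_const.indicator (hAmeas i)
  have ω₀_int : Integrable ω₀ (volume.restrict M) :=
    integrable_finsetSum _ fun i _ => (integrable_const (a i)).indicator (hAmeas i)
  have ω_int : Integrable ω (volume.restrict M) := hω.integrable le_top
  have hval : ∀ᵐ x ∂(volume.restrict M), ω₀ x ∈ S := by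
    filter_upwards [ae_restrict_mem hMopen.measurableSet] with x hx
    rw [← hAcover] at hx
    obtain ⟨i, hi⟩ := Set.mem_iUnion.1 hx
    have : ω₀ x = a i := by
      simp only [hω₀]
      rw [Finset.sum_eq_single_of_mem i (Finset.mem_univ i), Set.indicator_of_mem hi]
      intro j _ hj
      exact Set.indicator_of_notMem (Set.disjoint_right.1 (hAdisj j i hj) hi) _
    rw [this]
    exact Finset.mem_image_of_mem a (Finset.mem_univ i)
  refine ⟨⟨?_, ?_⟩, ?_⟩
  · rintro ⟨κ, hκ, hωκ⟩
    refine ⟨(integral_congr_ae hωκ).trans (hκ.integral_kernApply ω₀_int), fun i => ?_⟩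
    refine le_trans (le_of_eq (integral_congr_ae ?_)) (hκ.integral_ramp_kernApply_le ω₀_int (a i))
    filter_upwards [hωκ] with x hx
    rw [hx]
  · rintro ⟨hmean, hramp⟩
    exact exists_isBistochastic_of_convex_order ω_int ω₀_meas hS hval
      (ae_mem_Icc_of_ramp_le ω_int ω₀_int hS hval hmean (forall_S hramp)) hmean
      (integral_ramp_le_of_forall_mem ω_int ω₀_int hS hval hmean (forall_S hramp))
  · rintro ⟨hmean, hramp⟩
    have hbd := ae_mem_Icc_of_ramp_le ω_int ω₀_int hS hval hmean (forall_S hramp)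
    rw [hmin, hmax] at hbd
    exact ⟨hbd, integral_ramp_le_of_forall_mem ω_int ω₀_int hS hval hmean (forall_S hramp)⟩
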